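/- Let D ⊆ F_{q^m}^* be a proper nonempty F_q^*-invariant subset with −D = D and k = |D|. Then the Hamming weights of the codewords of C(M_D) are: wt(c(0,0)) = 0; wt(c(u,0)) = k for every u ∈ F_q^*; wt(c(0,v)) = q^m − q^{m−1} for every v ∈ F_{q^m}^*; and wt(c(u,v)) = q^m − q^{m−1} + Ψ_v(D) for every u ∈ F_q^* and v ∈ F_{q^m}^*. -/

import Mathlib

/-- The canonical additive character of a finite field `K` of characteristic
`p`:  `Ψ(x) = exp(2πi·Tr_{K/F_p}(x)/p)`. -/
noncomputable def canonAddChar (p : ℕ) (K : Type*) [Field K] [CharP K p] (x : K) : ℂ :=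
  letI := ZMod.algebra K p
  Complex.exp (2 * Real.pi * Complex.I * ((Algebra.trace (ZMod p) K x).val : ℂ) / p)

/-- The codeword `c(u,v)` of the code `C(M_D)`. -/
noncomputable def codewordMD (F E : Type*) [Field F] [Field E] [DecidableEq E] [Algebra F E]
    (D : Finset E) (w : F × E) : {x : E // x ≠ 0} → F :=
  fun x => w.1 * (if (x : E) ∈ D then (1 : F) else 0) + Algebra.trace F E (w.2 * (x : E))

/-- The canonical additive character is the standard character of `ZMod p` composed with the
absolute trace. -/
theorem canonAddChar_eq_stdAddChar (p : ℕ) [Fact p.Prime] (K : Type*) [Field K] [CharP K p]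
    (x : K) :
    letI := ZMod.algebra K p
    canonAddChar p K x = ZMod.stdAddChar (Algebra.trace (ZMod p) K x) := by
  simp only [canonAddChar, ZMod.stdAddChar_apply, ZMod.toCircle_apply]

/-- The canonical additive character of `E` factors through the trace to a subfield `F` as a
nontrivial additive character of `F`. -/
theorem exists_addChar_canonAddChar_eq (p : ℕ) [Fact p.Prime] (F E : Type*) [Field F] [Field E]
    [Finite F] [Finite E] [Algebra F E] [CharP E p] :
    ∃ φ : AddChar F ℂ, φ ≠ 1 ∧ ∀ x : E, canonAddChar p E x = φ (Algebra.trace F E x) := by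
  have : CharP F p := (RingHom.charP_iff (algebraMap F E) (algebraMap F E).injective p).2 ‹_›
  let := ZMod.algebra E p
  let := ZMod.algebra F p
  have : IsScalarTower (ZMod p) F E :=
    IsScalarTower.of_algebraMap_eq' (Subsingleton.elim _ _)
  refine ⟨ZMod.stdAddChar.compAddMonoidHom (Algebra.trace (ZMod p) F).toAddMonoidHom,
    fun h => ?_, fun x => ?_⟩
  · obtain ⟨y, hy⟩ := Algebra.trace_surjective (ZMod p) F 1
    have h1 : ZMod.stdAddChar (1 : ZMod p) = (1 : ℂ) := by
      simpa [hy] using DFunLike.congr_fun h y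
    exact one_ne_zero (ZMod.injective_stdAddChar (h1.trans (AddChar.map_zero_eq_one _).symm))
  · rw [canonAddChar_eq_stdAddChar]
    simp [Algebra.trace_trace]

open Finset in
/-- The support of a codeword can be counted over all of `E`. -/
theorem card_filter_codewordMD_ne_zero {F E : Type*} [Field F] [Field E] [Fintype E]
    [DecidableEq F] [DecidableEq E] [Algebra F E] (D : Finset E) (hD0 : ∀ x ∈ D, x ≠ 0)
    (u : F) (v : E) :
    #{x : {x : E // x ≠ 0} | codewordMD F E D (u, v) x ≠ 0} =
      #{x : E | u * (if x ∈ D then 1 else 0) + Algebra.trace F E (v * x) ≠ 0} := by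
  rw [← card_map (Function.Embedding.subtype _)]
  congr 1
  ext x
  have h0 : (0 : E) ∉ D := fun h => hD0 0 h rfl
  simp only [codewordMD, mem_map, mem_filter_univ, Function.Embedding.subtype_apply, Subtype.exists,
    exists_and_right, exists_eq_right]
  refine ⟨fun ⟨_, h⟩ => (mem_filter.1 h).2, fun h => ⟨?_, mem_filter.2 ⟨mem_univ _, h⟩⟩⟩
  rintro rfl
  simp [h0] at h

open Finset in
/-- Hyperplane count: the number of `x` with nonzero trace of `v * x`. -/
theorem card_trace_mul_ne_zero {F E : Type*} [Field F] [Field E] [Fintype F] [Fintype E]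
    [DecidableEq F] [Algebra F E] {m : ℕ} (hm : 0 < m)
    (hE : Fintype.card E = Fintype.card F ^ m) {v : E} (hv : v ≠ 0) :
    #{x : E | Algebra.trace F E (v * x) ≠ 0} + Fintype.card F ^ (m - 1) = Fintype.card F ^ m := by
  classical
  let L : E →ₗ[F] F := Algebra.trace F E ∘ₗ LinearMap.mulLeft F v
  have hL : Function.Surjective L := fun c => by
    obtain ⟨y, hy⟩ := Algebra.trace_surjective F E c
    exact ⟨v⁻¹ * y, by simp [L, hv, hy]⟩
  have hker : Nat.card (LinearMap.ker L) = #{x : E | Algebra.trace F E (v * x) = 0} := by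
    rw [Nat.card_eq_fintype_card]
    exact Fintype.card_of_subtype _ fun x => by simp [L]
  have hprod := Submodule.card_eq_card_quotient_mul_card (LinearMap.ker L)
  rw [Nat.card_congr (L.quotKerEquivOfSurjective hL).toEquiv, hker, Nat.card_eq_fintype_card,
    Nat.card_eq_fintype_card, hE] at hprod
  obtain ⟨n, rfl⟩ : ∃ n, m = n + 1 := ⟨m - 1, by omega⟩
  have hzero : #{x : E | Algebra.trace F E (v * x) = 0} = Fintype.card F ^ n :=
    Nat.eq_of_mul_eq_mul_left (Fintype.card_pos (α := F)) (by rw [mul_comm, ← hprod, pow_succ'])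
  have hsum := card_filter_add_card_filter_not (s := (univ : Finset E))
    (fun x => Algebra.trace F E (v * x) = 0)
  rw [hzero, card_univ, hE] at hsum
  simpa [add_comm] using hsum

open Finset in
/-- All nonzero trace levels of an `F^*`-invariant set have the same size. -/
theorem card_filter_trace_eq_of_invariant {F E : Type*} [Field F] [Field E]
    [DecidableEq F] [Algebra F E] (D : Finset E)
    (hinv : ∀ l : F, l ≠ 0 → ∀ x ∈ D, algebraMap F E l * x ∈ D) (v : E) {a b : F}
    (ha : a ≠ 0) (hb : b ≠ 0) :
    #{x ∈ D | Algebra.trace F E (v * x) = a} = #{x ∈ D | Algebra.trace F E (v * x) = b} := by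
  have hle : ∀ {a b : F}, a ≠ 0 → b ≠ 0 →
      #{x ∈ D | Algebra.trace F E (v * x) = a} ≤ #{x ∈ D | Algebra.trace F E (v * x) = b} := by
    intro a b ha hb
    have hl : b / a ≠ 0 := div_ne_zero hb ha
    refine card_le_card_of_injOn (fun x => algebraMap F E (b / a) * x) (fun x hx => ?_)
      fun x _ y _ hxy => mul_left_cancel₀ ((map_ne_zero (algebraMap F E)).2 hl) hxy
    simp only [coe_filter, Set.mem_ofPred_eq] at hx ⊢
    refine ⟨hinv _ hl x hx.1, ?_⟩
    rw [mul_left_comm, ← Algebra.smul_def, map_smul, hx.2, smul_eq_mul, div_mul_cancel₀ _ ha]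
  exact le_antisymm (hle ha hb) (hle hb ha)

open Finset in
/-- The character sum over an `F^*`-invariant set in terms of its trace levels. -/
theorem sum_addChar_trace_of_invariant {F E : Type*} [Field F] [Field E] [Fintype F]
    [DecidableEq F] [Algebra F E] (D : Finset E)
    (hinv : ∀ l : F, l ≠ 0 → ∀ x ∈ D, algebraMap F E l * x ∈ D) (v : E)
    {φ : AddChar F ℂ} (hφ : φ ≠ 1) {a : F} (ha : a ≠ 0) :
    ∑ x ∈ D, φ (Algebra.trace F E (v * x)) =
      #{x ∈ D | Algebra.trace F E (v * x) = 0} - #{x ∈ D | Algebra.trace F E (v * x) = a} := by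
  have hsum : ∑ c : F, φ c = 0 := AddChar.sum_eq_zero_of_ne_one hφ
  rw [← add_sum_erase univ _ (mem_univ (0 : F)), AddChar.map_zero_eq_one] at hsum
  have hfib : ∀ c : F, ∑ x ∈ D with Algebra.trace F E (v * x) = c,
      φ (Algebra.trace F E (v * x)) = #{x ∈ D | Algebra.trace F E (v * x) = c} * φ c := by
    intro c
    rw [sum_congr rfl fun x hx => by rw [(mem_filter.1 hx).2], sum_const, nsmul_eq_mul]
  rw [← sum_fiberwise D (fun x => Algebra.trace F E (v * x)), sum_congr rfl fun c _ => hfib c,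
    ← add_sum_erase univ _ (mem_univ (0 : F)), AddChar.map_zero_eq_one,
    sum_congr rfl fun c hc => by
      rw [card_filter_trace_eq_of_invariant D hinv v (ne_of_mem_erase hc) ha],
    ← mul_sum, eq_neg_of_add_eq_zero_right hsum]
  ring

open Finset in
/-- Adding `u • f_D` changes the weight of a trace codeword only on `D`, at the trace levels
`0` and `-u`. -/
theorem card_indicator_add_trace_ne_zero {F E : Type*} [Field F] [Field E] [Fintype E]
    [DecidableEq F] [DecidableEq E] [Algebra F E] (D : Finset E) {u : F} (hu : u ≠ 0) (v : E) :
    #{x : E | u * (if x ∈ D then 1 else 0) + Algebra.trace F E (v * x) ≠ 0} +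
        #{x ∈ D | Algebra.trace F E (v * x) = -u} =
      #{x : E | Algebra.trace F E (v * x) ≠ 0} + #{x ∈ D | Algebra.trace F E (v * x) = 0} := by
  have hD : ∀ c : F, #{x ∈ D | Algebra.trace F E (v * x) = c} =
      #{x : E | x ∈ D ∧ Algebra.trace F E (v * x) = c} := fun c => by
    congr 1; ext; simp
  simp only [hD, card_filter, ← sum_add_distrib]
  refine sum_congr rfl fun x _ => ?_
  have hiff : u + Algebra.trace F E (v * x) = 0 ↔ Algebra.trace F E (v * x) = -u := by
    rw [add_comm, add_eq_zero_iff_eq_neg]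
  by_cases hx : x ∈ D
  · by_cases h1 : Algebra.trace F E (v * x) = -u
    · simp [hx, h1, hu]
    · by_cases h2 : Algebra.trace F E (v * x) = 0
      · simp [hx, h2, hu]
      · simp [hx, hiff, h1, h2]
  · simp [hx]

open Finset in
/-- Weight distribution of `C(M_D)` for a proper nonempty `F_q^*`-invariant
`D ⊆ F_{q^m}^*` with `−D = D` and `k = |D|`:  `wt(c(0,0)) = 0`,
`wt(c(u,0)) = k` for `u ≠ 0`, `wt(c(0,v)) = q^m − q^{m−1}` for `v ≠ 0`, and
`wt(c(u,v)) = q^m − q^{m−1} + Ψ_v(D)` for `u ≠ 0`, `v ≠ 0`. -/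
theorem weight_distribution_CMD {p e m q : ℕ} [Fact p.Prime] (he : 0 < e) (hm : 0 < m)
    (hq : q = p ^ e) {F E : Type*} [Field F] [Field E] [Fintype F] [Fintype E]
    [DecidableEq F] [DecidableEq E] [Algebra F E] [CharP E p]
    (hF : Fintype.card F = q) (hE : Fintype.card E = q ^ m)
    (D : Finset E) (hD0 : ∀ x ∈ D, x ≠ 0) (hDne : D.Nonempty)
    (hDproper : (D : Set E) ≠ {x : E | x ≠ 0}) (hDneg : ∀ d ∈ D, -d ∈ D)
    (hinv : ∀ l : F, l ≠ 0 → ∀ x ∈ D, algebraMap F E l * x ∈ D) :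
    ((univ.filter (fun x : {x : E // x ≠ 0} =>
        codewordMD F E D ((0 : F), (0 : E)) x ≠ 0)).card = 0) ∧
    (∀ u : F, u ≠ 0 →
      (univ.filter (fun x : {x : E // x ≠ 0} =>
        codewordMD F E D (u, (0 : E)) x ≠ 0)).card = D.card) ∧
    (∀ v : E, v ≠ 0 →
      (univ.filter (fun x : {x : E // x ≠ 0} =>
        codewordMD F E D ((0 : F), v) x ≠ 0)).card = q ^ m - q ^ (m - 1)) ∧
    (∀ u : F, u ≠ 0 → ∀ v : E, v ≠ 0 →
      ((univ.filter (fun x : {x : E // x ≠ 0} =>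
          codewordMD F E D (u, v) x ≠ 0)).card : ℂ) =
        (q : ℂ) ^ m - (q : ℂ) ^ (m - 1) + ∑ x ∈ D, canonAddChar p E (v * x)) := by
  subst hF
  refine ⟨?_, fun u hu => ?_, fun v hv => ?_, fun u hu v hv => ?_⟩
  · rw [card_filter_codewordMD_ne_zero D hD0]
    simp
  · rw [card_filter_codewordMD_ne_zero D hD0]
    simp [hu]
  · rw [card_filter_codewordMD_ne_zero D hD0, ← card_trace_mul_ne_zero hm hE hv]
    simp
  · obtain ⟨φ, hφ, hφE⟩ := exists_addChar_canonAddChar_eq p F E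
    simp only [hφE]
    rw [card_filter_codewordMD_ne_zero D hD0,
      sum_addChar_trace_of_invariant D hinv v hφ (neg_ne_zero.2 hu)]
    have h1 := congrArg (Nat.cast : ℕ → ℂ) (card_indicator_add_trace_ne_zero D hu v)
    have h2 := congrArg (Nat.cast : ℕ → ℂ) (card_trace_mul_ne_zero hm hE hv)
    push_cast at h1 h2
    linear_combination h1 + h2
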